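/- For every real number q, every real number x, and every positive integer n, ∑_{k=0}^{n} C(n,k) · B(q,k) · (x+1)^{n−k} · x^k = ∑_{k=0}^{n} B(q,n−k) · B(q+k,k) · (−1)^{n−k} · (x+1)^k. -/

import Mathlib

open Finset

/-- The generalized binomial coefficient `B(q, k) = (∏_{i=0}^{k-1} (q - i)) / k!`. -/
noncomputable def genBinom (q : ℝ) (k : ℕ) : ℝ :=
  (∏ i ∈ Finset.range k, (q - i)) / k.factorial

theorem genBinom_eq (q : ℝ) (k : ℕ) : genBinom q k = Ring.choose q k := by
  unfold genBinom
  have h := Ring.descPochhammer_eq_factorial_smul_choose q k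
  rw [Polynomial.descPochhammer_smeval_eq_ascPochhammer, Polynomial.ascPochhammer_smeval_eq_eval,
    ← descPochhammer_eval_eq_ascPochhammer, descPochhammer_eval_eq_prod_range, nsmul_eq_mul] at h
  rw [h, mul_div_cancel_left₀]
  positivity

theorem coeff_aux (q : ℝ) (j m : ℕ) :
    ∑ k ∈ Finset.range (j + m + 1), ((j + m).choose k : ℝ) * Ring.choose q k * (k.choose j : ℝ)
      = Ring.choose q j * Ring.choose (q + m) m := by
  rw [add_assoc, Finset.sum_range_add, Finset.sum_eq_zero, zero_add]
  · have hv := Ring.add_choose_eq (r := q - j) (s := ((j + m : ℕ) : ℝ)) m (Commute.all _ _)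
    rw [show q - j + ((j + m : ℕ) : ℝ) = q + m by push_cast; ring] at hv
    rw [hv, Finset.Nat.sum_antidiagonal_eq_sum_range_succ_mk, Finset.mul_sum]
    refine Finset.sum_congr rfl fun a ha => ?_
    have ha' : a ≤ m := by simpa [Nat.lt_succ_iff] using ha
    have h1 := Ring.choose_smul_choose q (Nat.le_add_right j a)
    rw [nsmul_eq_mul, Nat.add_sub_cancel_left] at h1
    rw [Ring.choose_natCast, Nat.choose_symm_of_eq_add (show j + m = (m - a) + (j + a) by omega)]
    linear_combination ((j + m).choose (j + a) : ℝ) * h1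
  · intro k hk
    rw [Nat.choose_eq_zero_of_lt (Finset.mem_range.1 hk)]
    simp

/-- Identity (17), valid for arbitrary real `q`. -/
theorem identity_17 (q x : ℝ) (n : ℕ) (hn : 0 < n) :
    ∑ k ∈ Finset.range (n + 1),
      (n.choose k : ℝ) * genBinom q k * (x + 1) ^ (n - k) * x ^ k =
    ∑ k ∈ Finset.range (n + 1),
      genBinom q (n - k) * genBinom (q + k) k * (-1) ^ (n - k) * (x + 1) ^ k := by
  simp only [genBinom_eq]
  have hL : ∀ k ∈ Finset.range (n + 1),
      (n.choose k : ℝ) * Ring.choose q k * (x + 1) ^ (n - k) * x ^ k =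
      ∑ j ∈ Finset.range (n + 1), ((n.choose k : ℝ) * Ring.choose q k * (k.choose j : ℝ)) *
        ((-1) ^ j * (x + 1) ^ (n - j)) := by
    intro k hk
    have hk' : k ≤ n := by simpa [Nat.lt_succ_iff] using hk
    have hx : x ^ k = ∑ j ∈ Finset.range (k + 1),
        (-1 : ℝ) ^ j * (x + 1) ^ (k - j) * (k.choose j : ℝ) := by
      rw [← add_pow]; congr 1; ring
    rw [hx, Finset.mul_sum]
    rw [← Finset.sum_subset (Finset.range_mono (Nat.succ_le_succ hk'))]
    · refine Finset.sum_congr rfl fun j hj => ?_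
      have hj' : j ≤ k := by simpa [Nat.lt_succ_iff] using hj
      rw [show n - j = (n - k) + (k - j) by omega, pow_add]
      ring
    · intro j _ hj
      rw [Nat.choose_eq_zero_of_lt (show k < j by simpa using hj)]
      simp
  rw [Finset.sum_congr rfl hL, Finset.sum_comm, ← Finset.sum_range_reflect]
  refine Finset.sum_congr rfl fun k hk => ?_
  have hk' : k ≤ n := by simpa [Nat.lt_succ_iff] using hk
  rw [← Finset.sum_mul, show n + 1 - 1 - k = n - k by omega, show n - (n - k) = k by omega]
  have h := coeff_aux q (n - k) k
  rw [show n - k + k = n by omega] at h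
  rw [h]
  ring
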